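/- arXiv:1503.02447 — 5 statements merged into one kernel-verified Lean document; each statement's English description precedes it below -/
import Mathlib

section
/- Let C be a category, 𝒯 = (T, η, μ) a monad on C and ℰ = (E, l, r) 𝒯-equations, under the standing assumptions. Then for every 𝒯-algebra (A, α), the codomain (A/ℰ, α/ℰ) of the coequalizer s_(A,α) satisfies the equations ℰ, i.e., (α/ℰ) ∘ l_{A/ℰ} = (α/ℰ) ∘ r_{A/ℰ}. -/
open CategoryTheory CategoryTheory.Limits

universe v u

namespace QuotDL

variable {C : Type u} [Category.{v} C]

variable (T : Monad C) (E : C ⥤ C) (l r : E ⟶ (T : C ⥤ C))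

/-- The free extension `α ∘ l♯ : (TEA, μ) ⟶ (A, α)` of `α ∘ l_A`, as a `T`-algebra morphism. -/
def lhsHom (A : T.Algebra) : T.free.obj (E.obj A.A) ⟶ A :=
  (T.adj.homEquiv (E.obj A.A) A).symm (l.app A.A ≫ A.a)

/-- The free extension `α ∘ r♯ : (TEA, μ) ⟶ (A, α)` of `α ∘ r_A`, as a `T`-algebra morphism. -/
def rhsHom (A : T.Algebra) : T.free.obj (E.obj A.A) ⟶ A :=
  (T.adj.homEquiv (E.obj A.A) A).symm (r.app A.A ≫ A.a)

variable [HasCoequalizers T.Algebra]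

/-- The quotient algebra `(A/ℰ, α/ℰ)`, i.e. the codomain of the coequalizer of
`α ∘ l♯` and `α ∘ r♯` in `Alg(T)`. -/
noncomputable def quotAlg (A : T.Algebra) : T.Algebra :=
  coequalizer (lhsHom T E l A) (rhsHom T E r A)

/-- The coequalizer map `s_(A,α) : (A,α) ⟶ (A/ℰ, α/ℰ)`. -/
noncomputable def sMap (A : T.Algebra) : A ⟶ quotAlg T E l r A :=
  coequalizer.π _ _

theorem comp_sMap (A : T.Algebra) :
    (l.app A.A ≫ A.a) ≫ (sMap T E l r A).f = (r.app A.A ≫ A.a) ≫ (sMap T E l r A).f := by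
  have h : lhsHom T E l A ≫ sMap T E l r A = rhsHom T E r A ≫ sMap T E l r A :=
    coequalizer.condition _ _
  have h' := congrArg (T.adj.homEquiv _ _) h
  rw [Adjunction.homEquiv_naturality_right, Adjunction.homEquiv_naturality_right,
    lhsHom, rhsHom, Equiv.apply_symm_apply, Equiv.apply_symm_apply] at h'
  exact h'

/-- Under the standing assumptions, for every `T`-algebra `(A, α)`, the
codomain `(A/ℰ, α/ℰ)` of the coequalizer `s_(A,α)` satisfies the equations `ℰ`, i.e.
`(α/ℰ) ∘ l_{A/ℰ} = (α/ℰ) ∘ r_{A/ℰ}`. -/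
theorem quotAlg_satisfies_equations
    (hU : ∀ {A B : T.Algebra} (f : A ⟶ B), RegularEpi f → Epi f.f)
    (hTU : ∀ {A B : T.Algebra} (f : A ⟶ B), RegularEpi f → Epi ((T : C ⥤ C).map f.f))
    (hEU : ∀ {A B : T.Algebra} (f : A ⟶ B), RegularEpi f → Epi (E.map f.f))
    (A : T.Algebra) :
    l.app (quotAlg T E l r A).A ≫ (quotAlg T E l r A).a =
      r.app (quotAlg T E l r A).A ≫ (quotAlg T E l r A).a := by
  have : Epi (E.map (sMap T E l r A).f) := hEU _ (coequalizerRegular _ _)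
  rw [← cancel_epi (E.map (sMap T E l r A).f), l.naturality_assoc, r.naturality_assoc,
    (sMap T E l r A).h, ← Category.assoc, ← Category.assoc]
  exact comp_sMap T E l r A

end QuotDL
end

section
/- Let λ : TF ⇒ FT be a distributive law of a monad 𝒯 = (T, η, μ) over an endofunctor F, and let φ : X → FTX be a corecursive equation. Setting φ^λ = Fμ_X ∘ λ_{TX} ∘ Tφ : TX → FTX, the triple (TX, μ_X, φ^λ) is a λ-bialgebra, and η_X : X → TX is a solution of φ in it. -/
open CategoryTheory

universe v u

namespace BialgDL

variable {C : Type u} [Category.{v} C]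

/-- A distributive law of a monad `T` over an endofunctor `F`:
a natural transformation `λ : TF ⟹ FT` compatible with unit and multiplication. -/
structure DistLaw (T : Monad C) (F : C ⥤ C) where
  nat : F ⋙ (T : C ⥤ C) ⟶ (T : C ⥤ C) ⋙ F
  unit : ∀ X : C, T.η.app (F.obj X) ≫ nat.app X = F.map (T.η.app X)
  mult : ∀ X : C, T.μ.app (F.obj X) ≫ nat.app X =
    (T : C ⥤ C).map (nat.app X) ≫ nat.app ((T : C ⥤ C).obj X) ≫ F.map (T.μ.app X)

/-- The `F`-coalgebra structure `φ^λ = Fμ_X ∘ λ_{TX} ∘ Tφ` on `TX` induced by a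
corecursive equation `φ : X ⟶ FTX`. -/
def corecExt {T : Monad C} {F : C ⥤ C} (L : DistLaw T F) {X : C}
    (φ : X ⟶ F.obj ((T : C ⥤ C).obj X)) :
    (T : C ⥤ C).obj X ⟶ F.obj ((T : C ⥤ C).obj X) :=
  (T : C ⥤ C).map φ ≫ L.nat.app ((T : C ⥤ C).obj X) ≫ F.map (T.μ.app X)

/-- `(A, α, β)` is a `λ`-bialgebra: `α` is a `𝒯`-algebra, `β` an `F`-coalgebra, and
`β ∘ α = Fα ∘ λ_A ∘ Tβ`. -/
def IsBialgebra {T : Monad C} {F : C ⥤ C} (L : DistLaw T F) {A : C}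
    (α : (T : C ⥤ C).obj A ⟶ A) (β : A ⟶ F.obj A) : Prop :=
  T.η.app A ≫ α = 𝟙 A ∧
  T.μ.app A ≫ α = (T : C ⥤ C).map α ≫ α ∧
  α ≫ β = (T : C ⥤ C).map β ≫ L.nat.app A ≫ F.map α

/-- `f : X ⟶ A` is a solution of the corecursive equation `φ : X ⟶ FTX` in the bialgebra
`(A, α, β)`: `β ∘ f = Fα ∘ FTf ∘ φ`. -/
def IsSolution (T : Monad C) (F : C ⥤ C) {X A : C}
    (φ : X ⟶ F.obj ((T : C ⥤ C).obj X))
    (α : (T : C ⥤ C).obj A ⟶ A) (β : A ⟶ F.obj A) (f : X ⟶ A) : Prop :=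
  f ≫ β = φ ≫ F.map ((T : C ⥤ C).map f) ≫ F.map α

/-- `g` is a morphism of `λ`-bialgebras: both a `𝒯`-algebra homomorphism and an
`F`-coalgebra morphism. -/
def IsBialgHom (T : Monad C) (F : C ⥤ C) {A B : C}
    (αA : (T : C ⥤ C).obj A ⟶ A) (βA : A ⟶ F.obj A)
    (αB : (T : C ⥤ C).obj B ⟶ B) (βB : B ⟶ F.obj B) (g : A ⟶ B) : Prop :=
  (T : C ⥤ C).map g ≫ αB = αA ≫ g ∧ g ≫ βB = βA ≫ F.map g

theorem mu_comp_corecExt {T : Monad C} {F : C ⥤ C} (L : DistLaw T F) {X : C}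
    (φ : X ⟶ F.obj ((T : C ⥤ C).obj X)) :
    T.μ.app X ≫ corecExt L φ =
      (T : C ⥤ C).map (corecExt L φ) ≫ L.nat.app ((T : C ⥤ C).obj X) ≫ F.map (T.μ.app X) := by
  have hφ : T.μ.app X ≫ (T : C ⥤ C).map φ =
      (T : C ⥤ C).map ((T : C ⥤ C).map φ) ≫ T.μ.app (F.obj ((T : C ⥤ C).obj X)) :=
    (T.μ.naturality φ).symm
  have hμ : (T : C ⥤ C).map (F.map (T.μ.app X)) ≫ L.nat.app ((T : C ⥤ C).obj X) =
      L.nat.app ((T : C ⥤ C).obj ((T : C ⥤ C).obj X)) ≫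
        F.map ((T : C ⥤ C).map (T.μ.app X)) :=
    L.nat.naturality (T.μ.app X)
  simp only [corecExt, Functor.map_comp, Category.assoc]
  rw [reassoc_of% hφ, reassoc_of% (L.mult ((T : C ⥤ C).obj X)), reassoc_of% hμ,
    ← F.map_comp, ← F.map_comp, T.assoc]

theorem eta_comp_corecExt {T : Monad C} {F : C ⥤ C} (L : DistLaw T F) {X : C}
    (φ : X ⟶ F.obj ((T : C ⥤ C).obj X)) : T.η.app X ≫ corecExt L φ = φ := by
  have hφ : T.η.app X ≫ (T : C ⥤ C).map φ = φ ≫ T.η.app (F.obj ((T : C ⥤ C).obj X)) :=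
    (T.η.naturality φ).symm
  rw [corecExt, reassoc_of% hφ, reassoc_of% (L.unit ((T : C ⥤ C).obj X)), ← F.map_comp,
    T.left_unit]
  exact (congrArg (φ ≫ ·) (F.map_id _)).trans (Category.comp_id φ)

/-- **Statement 5.** Let `λ : TF ⟹ FT` be a distributive law of a monad `𝒯` over an
endofunctor `F`, and `φ : X ⟶ FTX` a corecursive equation.  Setting
`φ^λ = Fμ_X ∘ λ_{TX} ∘ Tφ`, the triple `(TX, μ_X, φ^λ)` is a `λ`-bialgebra, and
`η_X : X ⟶ TX` is a solution of `φ` in it. -/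
theorem free_bialgebra_and_unit_solution {T : Monad C} {F : C ⥤ C}
    (L : DistLaw T F) {X : C} (φ : X ⟶ F.obj ((T : C ⥤ C).obj X)) :
    IsBialgebra L (T.μ.app X) (corecExt L φ) ∧
    IsSolution T F φ (T.μ.app X) (corecExt L φ) (T.η.app X) := by
  refine ⟨⟨T.left_unit X, (T.assoc X).symm, mu_comp_corecExt L φ⟩, ?_⟩
  rw [IsSolution, eta_comp_corecExt, ← F.map_comp, T.right_unit]
  exact ((congrArg (φ ≫ ·) (F.map_id _)).trans (Category.comp_id φ)).symm

end BialgDL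
end

section
/- Let λ : TF ⇒ FT be a distributive law of a monad 𝒯 = (T, η, μ) over an endofunctor F, let φ : X → FTX be a corecursive equation, and let (A, α, β) be a λ-bialgebra. Then the assignments g ↦ g ∘ η_X and f ↦ α ∘ Tf are mutually inverse, establishing a one-to-one correspondence between λ-bialgebra morphisms g from (TX, μ_X, φ^λ) to (A, α, β) and solutions f of φ in (A, α, β). -/
open CategoryTheory

universe v u

namespace BialgDL

variable {C : Type u} [Category.{v} C]

/-- The map `α ∘ Tf` is an algebra homomorphism out of the free algebra. -/
theorem map_comp_algebra {T : Monad C} {X A : C} (α : (T : C ⥤ C).obj A ⟶ A)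
    (hα : T.μ.app A ≫ α = (T : C ⥤ C).map α ≫ α) (f : X ⟶ A) :
    (T : C ⥤ C).map ((T : C ⥤ C).map f ≫ α) ≫ α =
      T.μ.app X ≫ (T : C ⥤ C).map f ≫ α := by
  have h := T.μ.naturality f
  dsimp at h
  rw [Functor.map_comp, Category.assoc, ← hα, reassoc_of% h]

/-- The map `α ∘ Tf` induced by a solution `f` is a coalgebra morphism. -/
theorem IsSolution.map_comp_coalgebra {T : Monad C} {F : C ⥤ C} {L : DistLaw T F} {X A : C}
    {φ : X ⟶ F.obj ((T : C ⥤ C).obj X)} {α : (T : C ⥤ C).obj A ⟶ A} {β : A ⟶ F.obj A}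
    (hA : IsBialgebra L α β) {f : X ⟶ A} (hf : IsSolution T F φ α β f) :
    ((T : C ⥤ C).map f ≫ α) ≫ β =
      corecExt L φ ≫ F.map ((T : C ⥤ C).map f ≫ α) := by
  obtain ⟨-, hα, hβ⟩ := hA
  have h := L.nat.naturality ((T : C ⥤ C).map f ≫ α)
  dsimp only [Functor.comp_map, Functor.comp_obj] at h
  unfold IsSolution at hf
  rw [Category.assoc, hβ, ← Functor.map_comp_assoc, hf, ← F.map_comp, Functor.map_comp_assoc,
    reassoc_of% h, ← F.map_comp, map_comp_algebra α hα]
  simp [corecExt]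

/-- **Statement 6.** Let `λ : TF ⟹ FT` be a distributive law of `𝒯` over `F`,
`φ : X ⟶ FTX` a corecursive equation, and `(A, α, β)` a `λ`-bialgebra.  Then the
assignments `g ↦ g ∘ η_X` and `f ↦ α ∘ Tf` are mutually inverse, establishing a one-to-one
correspondence between `λ`-bialgebra morphisms `g : (TX, μ_X, φ^λ) ⟶ (A, α, β)` and
solutions `f` of `φ` in `(A, α, β)`. -/
theorem solutions_correspond_to_bialgebra_morphisms {T : Monad C} {F : C ⥤ C}
    (L : DistLaw T F) {X A : C} (φ : X ⟶ F.obj ((T : C ⥤ C).obj X))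
    (α : (T : C ⥤ C).obj A ⟶ A) (β : A ⟶ F.obj A)
    (hA : IsBialgebra L α β) :
    (∀ g : (T : C ⥤ C).obj X ⟶ A,
      IsBialgHom T F (T.μ.app X) (corecExt L φ) α β g →
        IsSolution T F φ α β (T.η.app X ≫ g) ∧
        (T : C ⥤ C).map (T.η.app X ≫ g) ≫ α = g) ∧
    (∀ f : X ⟶ A,
      IsSolution T F φ α β f →
        IsBialgHom T F (T.μ.app X) (corecExt L φ) α β ((T : C ⥤ C).map f ≫ α) ∧
        T.η.app X ≫ (T : C ⥤ C).map f ≫ α = f) := by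
  refine ⟨fun g ⟨hg, hg'⟩ => ?_, fun f hf => ⟨⟨map_comp_algebra α hA.2.1 f,
    hf.map_comp_coalgebra hA⟩, ?_⟩⟩
  · have h : (T : C ⥤ C).map (T.η.app X ≫ g) ≫ α = g := by
      rw [Functor.map_comp, Category.assoc, hg, ← Category.assoc, T.right_unit]
      exact Category.id_comp g
    refine ⟨?_, h⟩
    unfold IsSolution
    rw [← F.map_comp, h, Category.assoc, hg', ← Category.assoc, eta_comp_corecExt]
  · have h := T.η.naturality f
    dsimp at h
    rw [← reassoc_of% h, hA.1, Category.comp_id]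

end BialgDL
end

section
/- Let 𝒯 = (T, η, μ) and 𝒦 = (K, θ, ν) be monads on a category C, F an endofunctor on C, λ : TF ⇒ FT and κ : KF ⇒ FK distributive laws, and τ : λ ⇒ κ a morphism of distributive laws. For any corecursive equation φ : X → FTX, let Qφ = Fτ_X ∘ φ : X → FKX. Then τ_X : TX → KX is an F-coalgebra morphism from (TX, φ^λ) to (KX, (Qφ)^κ); equivalently, τ_X is a λ-bialgebra morphism from (TX, μ_X, φ^λ) to the λ-bialgebra (KX, ν_X ∘ τ_{KX}, (Qφ)^κ) obtained from the κ-bialgebra (KX, ν_X, (Qφ)^κ) by precomposing its algebra with τ. -/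
open CategoryTheory

universe v u

namespace BialgDL

variable {C : Type u} [Category.{v} C]

/-- **Statement 15.** Let `τ : λ ⟹ κ` be a morphism of distributive laws, and
`φ : X ⟶ FTX` a corecursive equation; let `Qφ = Fτ_X ∘ φ : X ⟶ FKX`.  Then
`τ_X : TX ⟶ KX` is an `F`-coalgebra morphism from `(TX, φ^λ)` to `(KX, (Qφ)^κ)`;
equivalently, `τ_X` is a `λ`-bialgebra morphism from `(TX, μ_X, φ^λ)` to the
`λ`-bialgebra `(KX, ν_X ∘ τ_{KX}, (Qφ)^κ)` obtained from the `κ`-bialgebra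
`(KX, ν_X, (Qφ)^κ)` by precomposing its algebra with `τ`. -/
theorem tau_is_bialgebra_morphism {T K : Monad C} {F : C ⥤ C}
    (L : DistLaw T F) (Kp : DistLaw K F) (tau : MonadHom T K)
    (htau : ∀ X : C,
      L.nat.app X ≫ F.map (tau.app X) = tau.app (F.obj X) ≫ Kp.nat.app X)
    {X : C} (φ : X ⟶ F.obj ((T : C ⥤ C).obj X)) :
    IsBialgHom T F
      (T.μ.app X) (corecExt L φ)
      (tau.app ((K : C ⥤ C).obj X) ≫ K.μ.app X) (corecExt Kp (φ ≫ F.map (tau.app X)))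
      (tau.app X) := by
  refine ⟨by simp [tau.app_μ], ?_⟩
  have hnat := L.nat.naturality (tau.app X)
  dsimp only [Functor.comp_obj, Functor.comp_map] at hnat
  calc tau.app X ≫ corecExt Kp (φ ≫ F.map (tau.app X))
    _ = (T : C ⥤ C).map (φ ≫ F.map (tau.app X)) ≫
          (tau.app (F.obj ((K : C ⥤ C).obj X)) ≫ Kp.nat.app ((K : C ⥤ C).obj X)) ≫
            F.map (K.μ.app X) := by
      rw [corecExt, Category.assoc, ← tau.toNatTrans.naturality_assoc]
    _ = (T : C ⥤ C).map φ ≫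
          ((T : C ⥤ C).map (F.map (tau.app X)) ≫ L.nat.app ((K : C ⥤ C).obj X)) ≫
            F.map (tau.app ((K : C ⥤ C).obj X)) ≫ F.map (K.μ.app X) := by
      rw [← htau]
      simp only [Functor.map_comp, Category.assoc]
    _ = corecExt L φ ≫ F.map (tau.app X) := by
      rw [hnat]
      simp only [corecExt, Category.assoc, ← Functor.map_comp, tau.app_μ]

end BialgDL
end

section
/- Let 𝒯 = (T, η, μ) and 𝒦 = (K, θ, ν) be monads on a category C, F an endofunctor on C, λ : TF ⇒ FT and κ : KF ⇒ FK distributive laws, and τ : λ ⇒ κ a morphism of distributive laws. Suppose (Z, ζ) is a final F-coalgebra, and let α : TZ → Z and α' : KZ → Z be the unique F-coalgebra morphisms from (TZ, λ_Z ∘ Tζ) and from (KZ, κ_Z ∘ Kζ), respectively, to (Z, ζ). Then α = α' ∘ τ_Z. -/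
open CategoryTheory

universe v u

namespace BialgDL

variable {C : Type u} [Category.{v} C]

/-- **Statement 17.** Let `τ : λ ⟹ κ` be a morphism of distributive laws and `(Z, ζ)` a
final `F`-coalgebra.  Let `α : TZ ⟶ Z` and `α' : KZ ⟶ Z` be the unique `F`-coalgebra
morphisms from `(TZ, λ_Z ∘ Tζ)` and from `(KZ, κ_Z ∘ Kζ)`, respectively, to `(Z, ζ)`.
Then `α = α' ∘ τ_Z`. -/
theorem induced_algebras_on_final_coalgebra {T K : Monad C} {F : C ⥤ C}
    (L : DistLaw T F) (Kp : DistLaw K F) (tau : MonadHom T K)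
    (htau : ∀ X : C,
      L.nat.app X ≫ F.map (tau.app X) = tau.app (F.obj X) ≫ Kp.nat.app X)
    (Z : C) (zeta : Z ⟶ F.obj Z)
    (hfinal : ∀ (X : C) (c : X ⟶ F.obj X), ∃! f : X ⟶ Z, f ≫ zeta = c ≫ F.map f)
    (α : (T : C ⥤ C).obj Z ⟶ Z)
    (hα : α ≫ zeta = ((T : C ⥤ C).map zeta ≫ L.nat.app Z) ≫ F.map α)
    (α' : (K : C ⥤ C).obj Z ⟶ Z)
    (hα' : α' ≫ zeta = ((K : C ⥤ C).map zeta ≫ Kp.nat.app Z) ≫ F.map α') :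
    α = tau.app Z ≫ α' := by
  refine (hfinal _ _).unique hα ?_
  calc (tau.app Z ≫ α') ≫ zeta
      = (tau.app Z ≫ (K : C ⥤ C).map zeta) ≫ Kp.nat.app Z ≫ F.map α' := by
        rw [Category.assoc, hα']
        simp only [Category.assoc]
    _ = (T : C ⥤ C).map zeta ≫ (tau.app (F.obj Z) ≫ Kp.nat.app Z) ≫ F.map α' := by
        rw [← tau.naturality zeta]
        simp only [Category.assoc]
    _ = ((T : C ⥤ C).map zeta ≫ L.nat.app Z) ≫ F.map (tau.app Z ≫ α') := by
        rw [← htau Z, F.map_comp]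
        simp only [Category.assoc]

end BialgDL
end
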